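/- There exists a constant C such that for all s ∈ ℕ and all integers k ≥ 0: |4^{−k}·(x (2^s) k) − φ_s(k−1)| ≤ C·8^{−s}, where φ_s(y) = 4^{−s}·φ(4^{−s}·y). -/

import Mathlib

open Real

/-- `xfun n k` is the multiplicity of the indecomposable tilting module `T(2n)` in
`V^{⊗2k}`, where `V` is the natural representation of `SL₂` in characteristic 2. -/
def xfun : ℕ → ℕ → ℕ
  | 0, 0 => 1
  | 0, _ + 1 => 0
  | _ + 1, 0 => 0
  | n + 1, k + 1 =>
      xfun n k + 2 * ∑ i ∈ Finset.range ((n + 1).factorization 2 + 1), xfun (n + 2 ^ i) k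

/-- The primitive Dirichlet character mod 4. -/
def dchi (n : ℕ) : ℤ := if n % 4 = 1 then 1 else if n % 4 = 3 then -1 else 0

/-- `φ(y) = (π/8)·∑_{n≥1} χ(n)·n·e^{−π²n²y/16}` for `y > 0`, and `0` for `y ≤ 0`. -/
noncomputable def phi (y : ℝ) : ℝ :=
  if 0 < y then
    (π / 8) * ∑' n : ℕ, (dchi n : ℝ) * (n : ℝ) * Real.exp (-(π ^ 2 * (n : ℝ) ^ 2 * y) / 16)
  else 0

/-- The rescaling `φ_s(y) = 4^{-s} φ(4^{-s} y)`. -/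
noncomputable def phis (s : ℕ) (y : ℝ) : ℝ := (4 : ℝ) ^ (-(s : ℤ)) * phi ((4 : ℝ) ^ (-(s : ℤ)) * y)

open PowerSeries in
noncomputable def XS (n : ℕ) : PowerSeries ℝ := PowerSeries.mk fun k => (xfun n k : ℝ)

lemma XS_zero : XS 0 = 1 := by
  ext k
  cases k with
  | zero => simp [XS, xfun]
  | succ k => simp [XS, xfun, PowerSeries.coeff_one]

lemma XS_succ (n : ℕ) : XS (n + 1) = PowerSeries.X * (XS n + 2 *
    ∑ i ∈ Finset.range ((n + 1).factorization 2 + 1), XS (n + 2 ^ i)) := by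
  ext k
  cases k with
  | zero => simp [XS, xfun]
  | succ k =>
    rw [PowerSeries.coeff_succ_X_mul]
    have : (2 : PowerSeries ℝ) = PowerSeries.C 2 := (map_ofNat _ 2).symm
    rw [this]
    simp [XS, xfun, PowerSeries.coeff_C_mul]

lemma fac_add {n j s : ℕ} (hn : 2 ^ s ∣ n) (hj0 : 0 < j) (hj : j < 2 ^ s) :
    (n + j).factorization 2 = j.factorization 2 := by
  have hp : Nat.Prime 2 := Nat.prime_two
  have key : ∀ k, 2 ^ k ∣ n + j ↔ 2 ^ k ∣ j := by
    intro k
    rcases le_total k s with h | h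
    · exact Nat.dvd_add_right ((pow_dvd_pow 2 h).trans hn)
    · constructor
      · intro h2
        have h3 : 2 ^ s ∣ j := (Nat.dvd_add_right hn).1 ((pow_dvd_pow 2 h).trans h2)
        exact absurd (Nat.le_of_dvd hj0 h3) (by omega)
      · intro h2
        have h3 : 2 ^ s ∣ j := (pow_dvd_pow 2 h).trans h2
        exact absurd (Nat.le_of_dvd hj0 h3) (by omega)
  apply le_antisymm
  · rw [← hp.pow_dvd_iff_le_factorization (by omega), ← key]
    exact Nat.ordProj_dvd _ _
  · rw [← hp.pow_dvd_iff_le_factorization (by omega), key]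
    exact Nat.ordProj_dvd _ _

lemma add_fac_le {j s i : ℕ} (hj0 : 0 < j) (hj : j < 2 ^ s) (hi : i ≤ j.factorization 2) :
    j + 2 ^ i ≤ 2 ^ s := by
  have hd : 2 ^ i ∣ j := (pow_dvd_pow 2 hi).trans (Nat.ordProj_dvd _ _)
  have his : i < s := by
    have := Nat.le_of_dvd hj0 hd
    exact (Nat.pow_lt_pow_iff_right (by norm_num : 1 < 2)).1 (this.trans_lt hj)
  obtain ⟨c, rfl⟩ := hd
  obtain ⟨d, rfl⟩ := Nat.exists_eq_add_of_le his.le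
  rw [pow_add] at hj ⊢
  have : c < 2 ^ d := lt_of_mul_lt_mul_left hj (Nat.zero_le _)
  calc 2 ^ i * c + 2 ^ i = 2 ^ i * (c + 1) := by ring
    _ ≤ _ := Nat.mul_le_mul_left _ this

lemma XS_add {n s : ℕ} (hn : 2 ^ s ∣ n) : ∀ j, j < 2 ^ s → XS (n + j) = XS n * XS j := by
  have key : ∀ k j, j < 2 ^ s → PowerSeries.coeff k (XS (n + j) - XS n * XS j) = 0 := by
    intro k
    induction k with
    | zero =>
      intro j hj
      rcases j with _ | j
      · simp [XS_zero]
      · rw [← add_assoc, XS_succ, XS_succ]; simp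
    | succ k ih =>
      intro j hj
      rcases j with _ | j
      · simp [XS_zero]
      · have e : XS (n + (j + 1)) - XS n * XS (j + 1) =
          PowerSeries.X * ((XS (n + j) - XS n * XS j) + PowerSeries.C 2 *
            ∑ i ∈ Finset.range ((j + 1).factorization 2 + 1),
              (XS (n + (j + 2 ^ i)) - XS n * XS (j + 2 ^ i))) := by
          rw [← add_assoc, XS_succ, XS_succ, add_assoc n j 1, fac_add hn (by omega) hj]
          rw [Finset.sum_sub_distrib, ← Finset.mul_sum]
          simp only [map_ofNat, add_assoc]
          ring
        rw [e, PowerSeries.coeff_succ_X_mul, map_add, PowerSeries.coeff_C_mul, map_sum,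
          ih j (by omega), Finset.sum_eq_zero, mul_zero, add_zero]
        intro i hi
        apply ih
        have := add_fac_le (by omega) hj (Nat.lt_succ_iff.1 (Finset.mem_range.1 hi))
        omega
  intro j hj
  rw [← sub_eq_zero]
  ext k
  simpa using key k j hj

noncomputable def AS (s : ℕ) : PowerSeries ℝ := XS (2 ^ s)
noncomputable def YS (s : ℕ) : PowerSeries ℝ := XS (2 ^ s - 1)
noncomputable def DS (s : ℕ) : PowerSeries ℝ :=
  1 - 2 * PowerSeries.X * ∑ i ∈ Finset.range (s + 1), YS i

lemma YS_succ (s : ℕ) : YS (s + 1) = AS s * YS s := by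
  have h1 : 0 < 2 ^ s := by positivity
  have h : 2 ^ (s + 1) - 1 = 2 ^ s + (2 ^ s - 1) := by rw [pow_succ]; omega
  rw [YS, h, XS_add (dvd_refl _) _ (by omega)]; rfl

lemma AS_eq (s : ℕ) : AS s * DS s = PowerSeries.X * YS s := by
  have h1 : 0 < 2 ^ s := by positivity
  obtain ⟨m, hm⟩ : ∃ m, 2 ^ s = m + 1 := ⟨2 ^ s - 1, by omega⟩
  have h2 : ∀ i ∈ Finset.range (s + 1), XS (m + 2 ^ i) = AS s * YS i := by
    intro i hi
    have h3 : 2 ^ i ≤ 2 ^ s :=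
      Nat.pow_le_pow_right (by norm_num) (Nat.lt_succ_iff.1 (Finset.mem_range.1 hi))
    have h4 : 0 < 2 ^ i := by positivity
    have : m + 2 ^ i = 2 ^ s + (2 ^ i - 1) := by omega
    rw [this, XS_add (dvd_refl _) _ (by omega)]; rfl
  have h := XS_succ m
  rw [← hm, Nat.Prime.factorization_pow Nat.prime_two] at h
  simp only [Finsupp.single_eq_same] at h
  rw [Finset.sum_congr rfl h2, ← Finset.mul_sum] at h
  have hy : YS s = XS m := by rw [YS, hm]; rfl
  rw [hy, DS]
  change AS s = _ at h
  linear_combination h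

lemma AS_const (s : ℕ) : PowerSeries.constantCoeff (AS s) = 0 := by
  have h1 : 0 < 2 ^ s := by positivity
  obtain ⟨m, hm⟩ : ∃ m, 2 ^ s = m + 1 := ⟨2 ^ s - 1, by omega⟩
  rw [AS, hm, XS_succ]; simp

lemma DS_ne (s : ℕ) : DS s ≠ 0 := by
  intro h
  have := congrArg PowerSeries.constantCoeff h
  simp [DS] at this

lemma AS_rec (s : ℕ) : AS (s + 1) * (1 - 2 * AS s ^ 2) = AS s ^ 2 := by
  have h1 := AS_eq s
  have h2 := AS_eq (s + 1)
  have h3 : DS (s + 1) = DS s - 2 * PowerSeries.X * YS (s + 1) := by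
    rw [DS, DS, Finset.sum_range_succ _ (s + 1)]; ring
  rw [h3, YS_succ] at h2
  apply mul_left_cancel₀ (DS_ne s)
  linear_combination h2 - (2 * AS s * AS (s + 1) + AS s) * h1

lemma AS_zero : AS 0 * (1 - 2 * PowerSeries.X) = PowerSeries.X := by
  have := AS_eq 0
  simpa [DS, YS, XS_zero] using this

noncomputable def HS : ℕ → ℝ → PowerSeries ℝ
  | 0, b => PowerSeries.X * PowerSeries.mk fun k => Real.sin b * (2 + 2 * Real.cos b) ^ k
  | s + 1, b => PowerSeries.C (1 / 2) * (HS s (b / 2) + HS s (b / 2 + π))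

lemma one_sub_ne (s : ℕ) : (1 - 2 * AS s ^ 2) ≠ 0 := by
  intro h
  have := congrArg PowerSeries.constantCoeff h
  simp [AS_const] at this

lemma HS_eq (s : ℕ) : ∀ b, HS s b * (1 - PowerSeries.C (2 * Real.cos b) * AS s) =
    PowerSeries.C (Real.sin b) * AS s := by
  induction s with
  | zero =>
    intro b
    have h0 : HS 0 b * (1 - PowerSeries.C (2 + 2 * Real.cos b) * PowerSeries.X) =
        PowerSeries.C (Real.sin b) * PowerSeries.X := by
      rw [HS]
      ext k
      rcases k with _ | _ | k
      · simp
      · rw [mul_assoc, PowerSeries.coeff_succ_X_mul]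
        simp
      · rw [mul_assoc, PowerSeries.coeff_succ_X_mul, mul_sub, mul_one, map_sub, ← mul_assoc,
          PowerSeries.coeff_succ_mul_X, PowerSeries.coeff_mul_C, PowerSeries.coeff_C_mul]
        simp [PowerSeries.coeff_X, pow_succ]
        ring
    have hA := AS_zero
    have hne : (1 - 2 * PowerSeries.X : PowerSeries ℝ) ≠ 0 := by
      intro h
      have := congrArg PowerSeries.constantCoeff h
      simp at this
    apply mul_right_cancel₀ hne
    have e : (PowerSeries.C (2 + 2 * Real.cos b) : PowerSeries ℝ) =
      2 + PowerSeries.C (2 * Real.cos b) := by rw [map_add, map_ofNat]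
    rw [e] at h0
    linear_combination h0 + (-HS 0 b * PowerSeries.C (2 * Real.cos b) - PowerSeries.C (Real.sin b)) * hA
  | succ s ih =>
    intro b
    have h1 := ih (b / 2)
    have h2 := ih (b / 2 + π)
    rw [Real.cos_add_pi, Real.sin_add_pi] at h2
    have hr := AS_rec s
    have hc : Real.cos b = 2 * Real.cos (b / 2) ^ 2 - 1 := by
      rw [← Real.cos_two_mul]; ring_nf
    have hs : Real.sin b = 2 * Real.sin (b / 2) * Real.cos (b / 2) := by
      rw [← Real.sin_two_mul]; ring_nf
    rw [hc, hs, HS]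
    apply mul_right_cancel₀ (one_sub_ne s)
    have hhalf : (PowerSeries.C (1 / 2 : ℝ)) * 2 = 1 := by
      rw [← map_ofNat (PowerSeries.C (R := ℝ)) 2, ← map_mul]; norm_num
    simp only [map_mul, map_sub, map_pow, map_neg, map_one, map_ofNat] at *
    set c := PowerSeries.C (Real.cos (b / 2))
    set t := PowerSeries.C (Real.sin (b / 2))
    set h := PowerSeries.C (1 / 2 : ℝ)
    set A := AS s
    set A' := AS (s + 1)
    set H1 := HS s (b / 2)
    set H2 := HS s (b / 2 + π)
    linear_combination (h * (1 + 2 * c * A)) * h1 + (h * (1 - 2 * c * A)) * h2 +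
      (-h * (H1 + H2) * 2 * (2 * c ^ 2 - 1) - 2 * t * c) * hr + 2 * t * c * A ^ 2 * hhalf

lemma HS_coeff (s : ℕ) : ∀ b k, PowerSeries.coeff (k + 1) (HS s b) =
    (1 / 2 ^ s) * ∑ j ∈ Finset.range (2 ^ s), Real.sin ((b + 2 * π * j) / 2 ^ s) *
      (2 + 2 * Real.cos ((b + 2 * π * j) / 2 ^ s)) ^ k := by
  induction s with
  | zero => intro b k; simp [HS]
  | succ s ih =>
    intro b k
    have split : ∀ (M : ℕ) (f : ℕ → ℝ), ∑ j ∈ Finset.range (2 * M), f j =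
        ∑ j ∈ Finset.range M, (f (2 * j) + f (2 * j + 1)) := by
      intro M f
      induction M with
      | zero => simp
      | succ M ihM =>
        rw [show 2 * (M + 1) = 2 * M + 1 + 1 by ring, Finset.sum_range_succ, Finset.sum_range_succ,
          ihM, Finset.sum_range_succ]
        ring
    rw [HS, PowerSeries.coeff_C_mul, map_add, ih, ih, show (2 : ℕ) ^ (s + 1) = 2 * 2 ^ s from pow_succ' 2 s, split, ← mul_add,
      ← Finset.sum_add_distrib, ← mul_assoc]
    congr 1
    · rw [pow_succ']; field_simp
    · apply Finset.sum_congr rfl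
      intro j _
      have e1 : (b / 2 + 2 * π * j) / 2 ^ s = (b + 2 * π * ((2 * j : ℕ) : ℝ)) / (2 ^ (s + 1)) := by
        push_cast; field_simp; ring
      have e2 : (b / 2 + π + 2 * π * j) / 2 ^ s =
          (b + 2 * π * ((2 * j + 1 : ℕ) : ℝ)) / (2 ^ (s + 1)) := by
        push_cast; field_simp; ring
      rw [e1, e2]

lemma xfun_formula (s k : ℕ) : (xfun (2 ^ s) (k + 1) : ℝ) =
    (1 / 2 ^ s) * ∑ j ∈ Finset.range (2 ^ s), Real.sin ((π / 2 + 2 * π * j) / 2 ^ s) *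
      (2 + 2 * Real.cos ((π / 2 + 2 * π * j) / 2 ^ s)) ^ k := by
  rw [← HS_coeff]
  have h := HS_eq s (π / 2)
  simp at h
  rw [h]
  simp [AS, XS]

noncomputable def PS (r : ℝ) (K : ℕ) (f : PowerSeries ℝ) : ℝ :=
  ∑ k ∈ Finset.range K, PowerSeries.coeff k f * r ^ k

lemma PS_add (r : ℝ) (K : ℕ) (f g : PowerSeries ℝ) : PS r K (f + g) = PS r K f + PS r K g := by
  simp [PS, add_mul, Finset.sum_add_distrib]

lemma PS_nonneg {r : ℝ} (hr : 0 ≤ r) (K : ℕ) {f : PowerSeries ℝ}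
    (hf : ∀ k, 0 ≤ PowerSeries.coeff k f) : 0 ≤ PS r K f :=
  Finset.sum_nonneg fun k _ => mul_nonneg (hf k) (pow_nonneg hr k)

lemma coeff_mul_nonneg {f g : PowerSeries ℝ} (hf : ∀ k, 0 ≤ PowerSeries.coeff k f)
    (hg : ∀ k, 0 ≤ PowerSeries.coeff k g) (k : ℕ) : 0 ≤ PowerSeries.coeff k (f * g) := by
  rw [PowerSeries.coeff_mul]
  exact Finset.sum_nonneg fun p _ => mul_nonneg (hf _) (hg _)

lemma PS_mul_le {r : ℝ} (hr : 0 ≤ r) (K : ℕ) {f g : PowerSeries ℝ}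
    (hf : ∀ k, 0 ≤ PowerSeries.coeff k f) (hg : ∀ k, 0 ≤ PowerSeries.coeff k g) :
    PS r K (f * g) ≤ PS r K f * PS r K g := by
  rw [PS, PS, PS, Finset.sum_mul_sum, ← Finset.sum_product']
  set F : ℕ × ℕ → ℝ := fun p => PowerSeries.coeff p.1 f * r ^ p.1 *
    (PowerSeries.coeff p.2 g * r ^ p.2) with hF
  have h1 : ∀ p, 0 ≤ F p := fun p => mul_nonneg (mul_nonneg (hf _) (pow_nonneg hr _))
    (mul_nonneg (hg _) (pow_nonneg hr _))
  set T := (Finset.range K ×ˢ Finset.range K).filter (fun p => p.1 + p.2 < K) with hT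
  have h2 : ∑ p ∈ T, F p ≤ ∑ p ∈ Finset.range K ×ˢ Finset.range K, F p :=
    Finset.sum_le_sum_of_subset_of_nonneg (Finset.filter_subset _ _) fun p _ _ => h1 p
  refine le_trans (le_of_eq ?_) h2
  rw [← Finset.sum_fiberwise_of_maps_to (s := T) (t := Finset.range K) (g := fun p => p.1 + p.2)]
  · apply Finset.sum_congr rfl
    intro k hk
    rw [PowerSeries.coeff_mul, Finset.sum_mul]
    apply Finset.sum_congr
    · ext ⟨a, b⟩
      simp [hT] at hk ⊢
      omega
    · rintro ⟨a, b⟩ hab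
      replace hab := (Finset.mem_filter.1 hab).2
      simp only [hF] at hab ⊢
      rw [← hab, pow_add]; ring
  · intro p hp
    simp [hT] at hp ⊢
    omega

lemma AS_nonneg (s k : ℕ) : 0 ≤ PowerSeries.coeff k (AS s) := by
  simp [AS, XS]

lemma PS_AS_le (t : ℝ) (K s : ℕ) :
    PS (1 / (4 * Real.cosh t ^ 2)) K (AS s) ≤ 1 / (2 * Real.cosh (2 ^ (s + 1) * t)) := by
  set r := 1 / (4 * Real.cosh t ^ 2) with hrdef
  have hr : 0 ≤ r := by positivity
  induction s with
  | zero =>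
    have hX : PS r K PowerSeries.X ≤ r := by
      rw [PS]
      have : ∀ k ∈ Finset.range K, PowerSeries.coeff k (PowerSeries.X : PowerSeries ℝ) * r ^ k =
          if k = 1 then r else 0 := by
        intro k _
        rw [PowerSeries.coeff_X]; split_ifs with h <;> simp [h]
      rw [Finset.sum_congr rfl this, Finset.sum_ite_eq']
      split_ifs <;> simp [hr]
    have hXn : ∀ k, 0 ≤ PowerSeries.coeff k (PowerSeries.X : PowerSeries ℝ) := by
      intro k; rw [PowerSeries.coeff_X]; split_ifs <;> simp
    have e : AS 0 = PowerSeries.X + (PowerSeries.X * AS 0 + PowerSeries.X * AS 0) := by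
      linear_combination AS_zero
    have h1 := PS_mul_le hr K hXn (AS_nonneg 0)
    have h2 := PS_nonneg hr K (AS_nonneg 0)
    have h3 : PS r K (PowerSeries.X * AS 0) ≤ r * PS r K (AS 0) :=
      h1.trans (mul_le_mul_of_nonneg_right hX h2)
    have h4 := congrArg (PS r K) e
    rw [PS_add, PS_add] at h4
    have hc : Real.cosh (2 ^ (0 + 1) * t) = 2 * Real.cosh t ^ 2 - 1 := by
      rw [zero_add, pow_one, Real.cosh_two_mul, Real.sinh_sq]; ring
    have hc1 := Real.one_le_cosh t
    rw [hc, le_div_iff₀ (by nlinarith)]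
    have h5 : r * (4 * Real.cosh t ^ 2) = 1 := by rw [hrdef]; field_simp
    nlinarith [mul_le_mul_of_nonneg_left (show PS r K (AS 0) ≤ r + 2 * (r * PS r K (AS 0)) by linarith) (show 0 ≤ 4 * Real.cosh t ^ 2 by positivity)]
  | succ s ih =>
    have e : AS (s + 1) = AS s * AS s + ((AS s * AS s) * AS (s + 1) + (AS s * AS s) * AS (s + 1)) := by
      linear_combination AS_rec s
    have hn := AS_nonneg s
    have h0 := PS_nonneg hr K hn
    have h2 := PS_nonneg hr K (AS_nonneg (s + 1))
    have h1 := PS_mul_le hr K hn hn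
    have h3 := PS_mul_le hr K (coeff_mul_nonneg hn hn) (AS_nonneg (s + 1))
    have h4 := congrArg (PS r K) e
    rw [PS_add, PS_add] at h4
    set c := Real.cosh (2 ^ (s + 1) * t) with hcdef
    have hc : Real.cosh (2 ^ (s + 1 + 1) * t) = 2 * c ^ 2 - 1 := by
      rw [pow_succ' 2 (s + 1), mul_assoc, Real.cosh_two_mul, Real.sinh_sq]; ring
    have hc1 : 1 ≤ c := Real.one_le_cosh _
    rw [hc, le_div_iff₀ (by nlinarith)]
    have h6 : PS r K (AS s * AS s) ≤ 1 / (4 * c ^ 2) := by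
      calc _ ≤ _ := h1
        _ ≤ (1 / (2 * c)) * (1 / (2 * c)) := mul_le_mul ih ih h0 (by positivity)
        _ = _ := by field_simp; norm_num
    have h7 := h3.trans (mul_le_mul_of_nonneg_right h6 h2)
    set P := PS r K (AS (s + 1))
    set q := 1 / (4 * c ^ 2) with hq
    have h5 : q * (4 * c ^ 2) = 1 := by rw [hq]; field_simp
    nlinarith [mul_le_mul_of_nonneg_left (show P ≤ q + 2 * (q * P) by linarith) (show 0 ≤ 4 * c ^ 2 by positivity)]

lemma xfun_le_exp (s k : ℕ) (hk : 0 < k) :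
    (xfun (2 ^ s) k : ℝ) / 4 ^ k ≤ Real.exp (-((2 ^ s) ^ 2 / k)) := by
  have hk' : (0 : ℝ) < k := by exact_mod_cast hk
  set t : ℝ := 2 ^ s / k with ht
  have hc1 := Real.one_le_cosh t
  have h := PS_AS_le t (k + 1) s
  have h1 : PowerSeries.coeff k (AS s) * (1 / (4 * Real.cosh t ^ 2)) ^ k ≤
      PS (1 / (4 * Real.cosh t ^ 2)) (k + 1) (AS s) := by
    rw [PS]
    exact Finset.single_le_sum (f := fun k => PowerSeries.coeff k (AS s) * (1 / (4 * Real.cosh t ^ 2)) ^ k)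
      (fun i _ => mul_nonneg (AS_nonneg s i) (by positivity)) (Finset.mem_range.2 (by omega))
  have h2 : PowerSeries.coeff k (AS s) = (xfun (2 ^ s) k : ℝ) := by simp [AS, XS]
  rw [h2] at h1
  have h3 := h1.trans h
  have h4 : 1 / (2 * Real.cosh (2 ^ (s + 1) * t)) ≤ Real.exp (-(2 ^ (s + 1) * t)) := by
    rw [Real.exp_neg, ← one_div]
    apply one_div_le_one_div_of_le (Real.exp_pos _)
    rw [Real.cosh_eq]
    have := Real.exp_pos (-(2 ^ (s + 1) * t))
    linarith
  have h5 : (Real.cosh t ^ 2) ^ k ≤ Real.exp (k * t ^ 2) := by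
    rw [Real.exp_nat_mul]
    apply pow_le_pow_left₀ (by positivity)
    calc Real.cosh t ^ 2 ≤ (Real.exp (t ^ 2 / 2)) ^ 2 :=
          pow_le_pow_left₀ (by positivity) (Real.cosh_le_exp_half_sq t) 2
      _ = _ := by rw [← Real.exp_nat_mul]; congr 1; push_cast; ring
  calc (xfun (2 ^ s) k : ℝ) / 4 ^ k
      = ((xfun (2 ^ s) k : ℝ) * (1 / (4 * Real.cosh t ^ 2)) ^ k) * (Real.cosh t ^ 2) ^ k := by
        rw [one_div, inv_pow, mul_pow]; field_simp
    _ ≤ Real.exp (-(2 ^ (s + 1) * t)) * Real.exp (k * t ^ 2) :=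
        mul_le_mul (h3.trans h4) h5 (by positivity) (by positivity)
    _ = _ := by
        rw [← Real.exp_add]; congr 1; rw [ht]; field_simp; ring

lemma dchi_abs_le (n : ℕ) : |(dchi n : ℝ)| ≤ 1 := by
  unfold dchi; split_ifs <;> simp

lemma summable_aux {y : ℝ} (hy : 0 < y) :
    Summable fun n : ℕ => (n : ℝ) * Real.exp (-(π ^ 2 * (n : ℝ) ^ 2 * y) / 16) := by
  have h := Real.summable_pow_mul_exp_neg_nat_mul 1 (show 0 < π ^ 2 * y / 16 by positivity)
  refine Summable.of_nonneg_of_le (fun n => by positivity) (fun n => ?_) h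
  rw [pow_one]
  apply mul_le_mul_of_nonneg_left _ (Nat.cast_nonneg n)
  apply Real.exp_le_exp.2
  have h1 : (n : ℝ) ≤ (n : ℝ) ^ 2 := by exact_mod_cast Nat.le_self_pow (by norm_num) n
  have h2 : 0 ≤ π ^ 2 * y / 16 := by positivity
  nlinarith [mul_le_mul_of_nonneg_left h1 h2]

lemma phi_term_abs_le (y : ℝ) (n : ℕ) :
    |(dchi n : ℝ) * (n : ℝ) * Real.exp (-(π ^ 2 * (n : ℝ) ^ 2 * y) / 16)| ≤
      (n : ℝ) * Real.exp (-(π ^ 2 * (n : ℝ) ^ 2 * y) / 16) := by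
  rw [mul_assoc, abs_mul, abs_of_nonneg (by positivity : 0 ≤ (n : ℝ) * Real.exp _)]
  exact mul_le_of_le_one_left (by positivity) (dchi_abs_le n)

lemma summable_phi {y : ℝ} (hy : 0 < y) :
    Summable fun n : ℕ => (dchi n : ℝ) * (n : ℝ) * Real.exp (-(π ^ 2 * (n : ℝ) ^ 2 * y) / 16) :=
  Summable.of_norm_bounded (summable_aux hy) (phi_term_abs_le y)

lemma tsum_four {f : ℕ → ℝ} (hf : Summable f) (h0 : ∀ n, f (2 * n) = 0) :
    ∑' n, f n = ∑' n, (f (4 * n + 1) + f (4 * n + 3)) := by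
  have hodd : Summable fun n => f (2 * n + 1) :=
    hf.comp_injective (i := fun n => 2 * n + 1) (fun a b h => by simpa using h)
  have h1 := tsum_even_add_odd (f := f) (by simp [h0, summable_zero]) hodd
  rw [← h1]
  simp only [h0, tsum_zero, zero_add]
  have ha : Summable fun n => f (2 * (2 * n) + 1) :=
    hodd.comp_injective (i := fun n => 2 * n) (fun a b h => by simpa using h)
  have hb : Summable fun n => f (2 * (2 * n + 1) + 1) :=
    hodd.comp_injective (i := fun n => 2 * n + 1) (fun a b h => by simpa using h)
  have h2 := tsum_even_add_odd (f := fun n => f (2 * n + 1)) ha hb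
  rw [← h2, ← ha.tsum_add hb]
  congr 1
  ext n
  congr 2 <;> ring

lemma phi_eq_oddKernel {y : ℝ} (hy : 0 < y) :
    phi y = π / 2 * HurwitzZeta.oddKernel ((1 / 4 : ℝ) : UnitAddCircle) (π * y) := by
  have h := (HurwitzZeta.hasSum_int_oddKernel (1 / 4) (show 0 < π * y by positivity))
  have h' := h.nat_add_neg_add_one
  rw [phi, if_pos hy, ← h'.tsum_eq, tsum_four (summable_phi hy)]
  · rw [← tsum_mul_left, ← tsum_mul_left]
    congr 1
    ext n
    have d1 : dchi (4 * n + 1) = 1 := by unfold dchi; rw [if_pos (by omega)]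
    have d3 : dchi (4 * n + 3) = -1 := by
      unfold dchi; rw [if_neg (by omega), if_pos (by omega)]
    rw [d1, d3]
    have e1 : -(π ^ 2 * ((4 * n + 1 : ℕ) : ℝ) ^ 2 * y) / 16 =
        -π * (((n : ℤ) : ℝ) + 1 / 4) ^ 2 * (π * y) := by push_cast; ring
    have e2 : -(π ^ 2 * ((4 * n + 3 : ℕ) : ℝ) ^ 2 * y) / 16 =
        -π * (((-(n + 1 : ℤ) : ℤ) : ℝ) + 1 / 4) ^ 2 * (π * y) := by push_cast; ring
    rw [e1, e2]
    push_cast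
    ring
  · intro n
    have : dchi (2 * n) = 0 := by unfold dchi; rw [if_neg (by omega), if_neg (by omega)]
    simp [this]

lemma exp_neg_le {v : ℝ} (hv : 0 < v) (p : ℕ) : Real.exp (-v) ≤ p.factorial / v ^ p := by
  have h := Real.pow_div_factorial_le_exp v hv.le p
  rw [Real.exp_neg, ← one_div, div_le_div_iff₀ (Real.exp_pos _) (by positivity)]
  rw [div_le_iff₀ (by positivity)] at h
  linarith

lemma phi_bound : ∃ C : ℝ, 0 ≤ C ∧ ∀ y, 0 < y → |phi y| ≤ C * y ^ 3 := by
  obtain ⟨p, hp, hO⟩ := HurwitzZeta.isBigO_atTop_sinKernel ((1 / 4 : ℝ) : UnitAddCircle)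
  obtain ⟨c, hc, hO⟩ := hO.exists_pos
  obtain ⟨X0, hX0⟩ := Filter.eventually_atTop.1 hO.bound
  set X1 := max X0 1 with hX1
  have hX1pos : 0 < X1 := lt_of_lt_of_le one_pos (le_max_right _ _)
  set y1 := 1 / (π * X1) with hy1
  have hy1pos : 0 < y1 := by positivity
  set M := π / 8 * ∑' n : ℕ, (n : ℝ) * Real.exp (-(π ^ 2 * (n : ℝ) ^ 2 * y1) / 16) with hM
  have hM0 : 0 ≤ M := by
    apply mul_nonneg (by positivity)
    exact tsum_nonneg fun n => by positivity
  set C1 := π / 2 * (c * (120 / p ^ 5)) * π ^ 3 with hC1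
  have hC10 : 0 ≤ C1 := by positivity
  refine ⟨C1 + M / y1 ^ 3, by positivity, fun y hy => ?_⟩
  rcases le_or_gt y y1 with h | h
  · have hx : 0 < π * y := by positivity
    have hx1 : π * y ≤ 1 / X1 := by
      calc π * y ≤ π * y1 := by gcongr
        _ = 1 / X1 := by rw [hy1]; field_simp
    have hu : X1 ≤ 1 / (π * y) := by
      rw [le_div_iff₀ hx]
      rw [le_div_iff₀ hX1pos] at hx1
      linarith
    have hx2 : π * y ≤ 1 := hx1.trans (by
      rw [div_le_one hX1pos]; exact le_max_right _ _)
    have hs := hX0 (1 / (π * y)) ((le_max_left _ _).trans hu)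
    rw [phi_eq_oddKernel hy, HurwitzZeta.oddKernel_functional_equation]
    set x := π * y with hxdef
    have he : ‖Real.exp (-p * (1 / x))‖ ≤ 120 / p ^ 5 * x ^ 5 := by
      rw [Real.norm_of_nonneg (Real.exp_pos _).le]
      have := exp_neg_le (show 0 < p / x by positivity) 5
      calc Real.exp (-p * (1 / x)) = Real.exp (-(p / x)) := by congr 1; ring
        _ ≤ _ := this
        _ = _ := by rw [div_pow]; norm_num [Nat.factorial]; field_simp
    have hrp : 1 / x ^ (3 / 2 : ℝ) ≤ 1 / x ^ 2 := by
      apply one_div_le_one_div_of_le (by positivity)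
      rw [← Real.rpow_natCast]
      exact Real.rpow_le_rpow_of_exponent_ge hx hx2 (by norm_num)
    rw [abs_mul, abs_of_nonneg (by positivity : 0 ≤ π / 2), abs_mul,
      abs_of_nonneg (by positivity : 0 ≤ 1 / x ^ (3 / 2 : ℝ))]
    rw [Real.norm_eq_abs] at hs
    calc _ ≤ π / 2 * (1 / x ^ 2 * (c * (120 / p ^ 5 * x ^ 5))) := by
          gcongr
          exact hs.trans (by gcongr)
      _ = C1 * y ^ 3 := by
          rw [hC1, hxdef]; field_simp
      _ ≤ (C1 + M / y1 ^ 3) * y ^ 3 := by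
          gcongr
          have : 0 ≤ M / y1 ^ 3 := by positivity
          linarith
  · have h1 : |phi y| ≤ M := by
      rw [phi, if_pos hy, abs_mul, abs_of_nonneg (by positivity : 0 ≤ π / 8), hM]
      gcongr
      rw [← Real.norm_eq_abs]
      apply tsum_of_norm_bounded (summable_aux hy1pos).hasSum
      intro n
      refine (phi_term_abs_le y n).trans ?_
      gcongr
    calc |phi y| ≤ M := h1
      _ = M / y1 ^ 3 * y1 ^ 3 := by field_simp
      _ ≤ M / y1 ^ 3 * y ^ 3 := by gcongr
      _ ≤ (C1 + M / y1 ^ 3) * y ^ 3 := by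
          gcongr
          linarith

lemma pt1 {g : ℝ} {m : ℕ} (hg : 0 < g) (hgp : g ≤ π) (hm : 1 ≤ m) :
    |Real.sin g * ((1 + Real.cos g) / 2) ^ m - g * Real.exp (-(g ^ 2 * m) / 4)| ≤
      726000 / (g ^ 3 * m ^ 3) := by
  have hm' : (0 : ℝ) < m := by exact_mod_cast hm
  set q := (1 + Real.cos g) / 2 with hq
  set p := Real.exp (-(g ^ 2 / 4)) with hp
  set E := Real.exp (-(g ^ 2 / 10)) with hE
  have hpi : π ^ 2 ≤ 10 := by nlinarith [Real.pi_lt_d2, Real.pi_pos]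
  have hq0 : 0 ≤ q := by rw [hq]; linarith [Real.neg_one_le_cos g]
  have hp0 : 0 < p := Real.exp_pos _
  have hE0 : 0 < E := Real.exp_pos _
  have hg10 : g ^ 2 / 10 ≤ g ^ 2 / π ^ 2 := by gcongr
  have hqE : q ≤ E := by
    have h1 := Real.cos_le_one_sub_mul_cos_sq (x := g) (by rwa [abs_of_pos hg])
    have h2 := Real.add_one_le_exp (-(g ^ 2 / 10))
    have h3 : 2 / π ^ 2 * g ^ 2 = 2 * (g ^ 2 / π ^ 2) := by ring
    rw [h3] at h1
    rw [hq]; linarith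
  have hpE : p ≤ E := Real.exp_le_exp.2 (by nlinarith [sq_nonneg g])
  have hp1 : p ≤ 1 := Real.exp_le_one_iff.2 (by nlinarith [sq_nonneg g])
  have hq1 : q ≤ 1 := by rw [hq]; linarith [Real.cos_le_one g]
  have hqp : |q - p| ≤ g ^ 4 := by
    rcases le_total g 1 with h | h
    · have hb := Real.cos_bound (x := g) (by rwa [abs_of_pos hg])
      rw [abs_of_pos hg] at hb
      have hg2 : g ^ 2 ≤ 1 := by nlinarith
      have he := Real.abs_exp_sub_one_sub_id_le (x := -(g ^ 2 / 4)) (by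
        rw [abs_neg, abs_of_nonneg (by positivity)]; linarith)
      rw [abs_le] at hb he ⊢
      have h4 : 0 < g ^ 4 := by positivity
      have h5 : (-(g ^ 2 / 4)) ^ 2 = g ^ 4 / 16 := by ring
      rw [h5] at he
      rw [hq]
      constructor <;> linarith [hb.1, hb.2, he.1, he.2]
    · have : (1 : ℝ) ≤ g ^ 4 := one_le_pow₀ h
      rw [abs_le]; constructor <;> linarith
  have hsin : |Real.sin g - g| ≤ g ^ 3 := by
    have h1 := Real.sin_gt_sub_cube hg
    have h2 := Real.sin_le hg.le
    have h3 : 0 < g ^ 3 := by positivity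
    rw [abs_le]; constructor <;> linarith
  set W := Real.exp (-(g ^ 2 * m / 10)) with hW
  have hEm : E ^ m = W := by
    rw [hE, ← Real.exp_nat_mul]; congr 1; ring
  have hpm : Real.exp (-(g ^ 2 * m) / 4) = p ^ m := by
    rw [hp, ← Real.exp_nat_mul]; congr 1; ring
  have hEm1 : E ^ (m - 1) ≤ 3 * W := by
    have h1 : E ^ m = E ^ (m - 1) * E := by rw [← pow_succ]; congr 1; omega
    have h2 : 1 ≤ 3 * E := by
      have h3 : Real.exp (g ^ 2 / 10) ≤ 3 := by
        have : g ^ 2 / 10 ≤ 1 := by nlinarith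
        linarith [Real.exp_le_exp.2 this, Real.exp_one_lt_d9]
      have h4 : E * Real.exp (g ^ 2 / 10) = 1 := by rw [hE, ← Real.exp_add]; simp
      nlinarith
    rw [← hEm, h1]
    have h5 : 0 ≤ E ^ (m - 1) := by positivity
    nlinarith
  have hpow : |q ^ m - p ^ m| ≤ g ^ 4 * m * (3 * W) := by
    refine (abs_pow_sub_pow_le q p m).trans ?_
    have : max |q| |p| ≤ E := by
      rw [abs_of_nonneg hq0, abs_of_pos hp0]; exact max_le hqE hpE
    have h2 : max |q| |p| ^ (m - 1) ≤ 3 * W :=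
      (pow_le_pow_left₀ (le_max_of_le_left (abs_nonneg _)) this _).trans hEm1
    gcongr
  have hqm : |q ^ m| ≤ W := by
    rw [abs_of_nonneg (by positivity), ← hEm]; gcongr
  have hW3 := exp_neg_le (show 0 < g ^ 2 * m / 10 by positivity) 3
  have hW4 := exp_neg_le (show 0 < g ^ 2 * m / 10 by positivity) 4
  rw [← hW] at hW3 hW4
  have hW0 : 0 < W := Real.exp_pos _
  calc _ = |(Real.sin g - g) * q ^ m + g * (q ^ m - p ^ m)| := by rw [hpm]; congr 1; ring
    _ ≤ |Real.sin g - g| * |q ^ m| + g * |q ^ m - p ^ m| := by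
        refine (abs_add_le _ _).trans ?_
        rw [abs_mul, abs_mul, abs_of_pos hg]
    _ ≤ g ^ 3 * W + g * (g ^ 4 * m * (3 * W)) := by gcongr
    _ = g ^ 3 * W + 3 * g ^ 5 * m * W := by ring
    _ ≤ g ^ 3 * ((Nat.factorial 3 : ℕ) / (g ^ 2 * m / 10) ^ 3) +
        3 * g ^ 5 * m * ((Nat.factorial 4 : ℕ) / (g ^ 2 * m / 10) ^ 4) := by gcongr
    _ = _ := by
        norm_num [Nat.factorial]; field_simp; norm_num

lemma pt2 {g : ℝ} {m : ℕ} (hgp : π ≤ g) (hm : 1 ≤ m) :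
    |g * Real.exp (-(g ^ 2 * m) / 4)| ≤ 726000 / (g ^ 3 * m ^ 3) := by
  have hm' : (0 : ℝ) < m := by exact_mod_cast hm
  have hg1 : 1 ≤ g := by linarith [Real.pi_gt_three]
  have hg : 0 < g := by linarith
  have h3 := exp_neg_le (show 0 < g ^ 2 * m / 4 by positivity) 3
  rw [abs_of_nonneg (by positivity), neg_div]
  calc _ ≤ g * ((Nat.factorial 3 : ℕ) / (g ^ 2 * m / 4) ^ 3) := by gcongr
    _ = 384 / (g ^ 3 * m ^ 3) * (1 / g ^ 2) := by norm_num [Nat.factorial]; field_simp; norm_num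
    _ ≤ 384 / (g ^ 3 * m ^ 3) * 1 := by
        gcongr
        rw [div_le_one (by positivity)]
        exact one_le_pow₀ hg1
    _ ≤ _ := by rw [mul_one]; gcongr; norm_num

lemma sum_range_four (F : ℕ → ℝ) (M : ℕ) :
    ∑ n ∈ Finset.range (4 * M), (dchi n : ℝ) * F n =
      ∑ i ∈ Finset.range M, (F (4 * i + 1) - F (4 * i + 3)) := by
  induction M with
  | zero => simp
  | succ M ih =>
    rw [show 4 * (M + 1) = 4 * M + 1 + 1 + 1 + 1 by ring, Finset.sum_range_succ,
      Finset.sum_range_succ, Finset.sum_range_succ, Finset.sum_range_succ, ih,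
      Finset.sum_range_succ _ M]
    have d0 : dchi (4 * M) = 0 := by unfold dchi; rw [if_neg (by omega), if_neg (by omega)]
    have d1 : dchi (4 * M + 1) = 1 := by unfold dchi; rw [if_pos (by omega)]
    have d2 : dchi (4 * M + 1 + 1) = 0 := by
      unfold dchi; rw [if_neg (by omega), if_neg (by omega)]
    have d3 : dchi (4 * M + 1 + 1 + 1) = -1 := by
      unfold dchi; rw [if_neg (by omega), if_pos (by omega)]
    rw [d0, d1, d2, d3]
    push_cast
    ring

lemma fold_sum (s : ℕ) (F : ℝ → ℝ) (hodd : ∀ x, F (-x) = -F x)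
    (hper : ∀ x, F (x + 2 * π) = F x) :
    ∑ j ∈ Finset.range (2 ^ s), F ((π / 2 + 2 * π * j) / 2 ^ s) =
      ∑ n ∈ Finset.range (2 * 2 ^ s), (dchi n : ℝ) * F (n * (π / (2 * 2 ^ s))) := by
  cases s with
  | zero => simp [Finset.sum_range_succ, dchi]
  | succ s =>
    set M := 2 ^ s with hM
    have h1 : 2 ^ (s + 1) = M + M := by rw [pow_succ, hM]; ring
    have h2 : 2 * 2 ^ (s + 1) = 4 * M := by rw [h1]; ring
    have h3 : (2 : ℝ) ^ (s + 1) = 2 * M := by rw [hM, pow_succ]; push_cast; ring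
    have hMpos : (0 : ℝ) < M := by rw [hM]; positivity
    rw [h2, h1, h3, sum_range_four (fun n => F (n * (π / (2 * (2 * M)))))]
    rw [Finset.sum_range_add, Finset.sum_sub_distrib, sub_eq_add_neg]
    congr 1
    · apply Finset.sum_congr rfl
      intro i _
      congr 1
      push_cast; field_simp; ring
    · rw [← Finset.sum_range_reflect, ← Finset.sum_neg_distrib]
      apply Finset.sum_congr rfl
      intro i hi
      rw [← hodd, ← hper (-_)]
      congr 1
      have : M - 1 - i + i + 1 = M := by have := Finset.mem_range.1 hi; omega
      have hc : ((M - 1 - i : ℕ) : ℝ) = M - 1 - i := by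
        rw [← congrArg (Nat.cast (R := ℝ)) this]
        push_cast
        rw [show ((M : ℕ) - 1 - i : ℕ) = M - 1 - i from rfl]
        ring
      push_cast [hc]
      field_simp
      ring

lemma regime_two (s m : ℕ) (hm : 1 ≤ m) :
    |(xfun (2 ^ s) (m + 1) : ℝ) / 4 ^ (m + 1) - phis s m| ≤
      2 * 726000 * (∑' n : ℕ, 1 / (n : ℝ) ^ 3) * ((2 ^ s) ^ 2 / m ^ 3) := by
  have hm' : (0 : ℝ) < m := by exact_mod_cast hm
  set N : ℝ := 2 ^ s with hN
  have hNpos : 0 < N := by positivity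
  set d := π / (2 * N) with hd
  have hdpos : 0 < d := by positivity
  set F : ℝ → ℝ := fun x => Real.sin x * ((1 + Real.cos x) / 2) ^ m with hF
  set G : ℝ → ℝ := fun x => x * Real.exp (-(x ^ 2 * m) / 4) with hG
  set Z := ∑' n : ℕ, 1 / (n : ℝ) ^ 3 with hZ
  have hx : (xfun (2 ^ s) (m + 1) : ℝ) / 4 ^ (m + 1) =
      1 / (4 * N) * ∑ n ∈ Finset.range (2 * 2 ^ s), (dchi n : ℝ) * F (n * d) := by
    rw [xfun_formula, ← fold_sum s F (by intro x; simp [hF]) (by intro x; simp [hF])]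
    rw [mul_div_assoc, Finset.sum_div, ← hN, Finset.mul_sum, Finset.mul_sum]
    apply Finset.sum_congr rfl
    intro j _
    simp only [hF]
    rw [show ∀ c : ℝ, 2 + 2 * c = 4 * ((1 + c) / 2) by intro c; ring, mul_pow]
    field_simp
    ring
  have h4 : (4 : ℝ) ^ (-(s : ℤ)) = 1 / N ^ 2 := by
    rw [zpow_neg, zpow_natCast, hN, ← pow_mul, mul_comm, pow_mul, one_div]; norm_num
  have hy : 0 < 1 / N ^ 2 * (m : ℝ) := by positivity
  have hphi : phis s m = 1 / (4 * N) * ∑' n : ℕ, (dchi n : ℝ) * G (n * d) := by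
    rw [phis, h4, phi, if_pos hy, ← mul_assoc, ← tsum_mul_left, ← tsum_mul_left]
    congr 1
    ext n
    simp only [hG]
    have : -(π ^ 2 * (n : ℝ) ^ 2 * (1 / N ^ 2 * m)) / 16 = -((n * d) ^ 2 * m) / 4 := by
      rw [hd]; field_simp; ring
    rw [this, hd]
    field_simp
    ring
  have hGs : Summable fun n : ℕ => (dchi n : ℝ) * G (n * d) := by
    have := (summable_phi hy).mul_left d
    refine this.congr fun n => ?_
    simp only [hG]
    have : -(π ^ 2 * (n : ℝ) ^ 2 * (1 / N ^ 2 * m)) / 16 = -((n * d) ^ 2 * m) / 4 := by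
      rw [hd]; field_simp; ring
    rw [this]
    ring
  set R := Finset.range (2 * 2 ^ s) with hR
  set FF : ℕ → ℝ := fun n => if n ∈ R then (dchi n : ℝ) * F (n * d) else 0 with hFF
  have hFsum : HasSum FF (∑ n ∈ R, (dchi n : ℝ) * F (n * d)) := by
    have h1 : ∑ n ∈ R, (dchi n : ℝ) * F (n * d) = ∑ n ∈ R, FF n :=
      Finset.sum_congr rfl fun n hn => by simp [hFF, hn]
    rw [h1]
    exact hasSum_sum_of_ne_finset_zero fun n hn => by simp [hFF, hn]
  have hdiff := hFsum.sub hGs.hasSum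
  have hZs : HasSum (fun n : ℕ => 726000 / (d ^ 3 * m ^ 3) * (1 / (n : ℝ) ^ 3))
      (726000 / (d ^ 3 * m ^ 3) * Z) :=
    (Real.summable_one_div_nat_pow.2 (by norm_num)).hasSum.mul_left _
  have hbound : ∀ n, ‖FF n - (dchi n : ℝ) * G (n * d)‖ ≤
      726000 / (d ^ 3 * m ^ 3) * (1 / (n : ℝ) ^ 3) := by
    intro n
    rcases Nat.eq_zero_or_pos n with rfl | hn
    · simp [hFF, dchi]
    have hn' : (0 : ℝ) < n := by exact_mod_cast hn
    have hnd : 0 < n * d := by positivity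
    have e : 726000 / (d ^ 3 * m ^ 3) * (1 / (n : ℝ) ^ 3) =
        726000 / ((n * d) ^ 3 * m ^ 3) := by field_simp
    have hpi : 2 * N * d = π := by rw [hd]; field_simp
    rw [e, Real.norm_eq_abs]
    by_cases hnR : n ∈ R
    · have : (n : ℝ) ≤ 2 * N := by
        rw [hN]; exact_mod_cast (Finset.mem_range.1 hnR).le
      have h1 := pt1 hnd (by rw [← hpi]; gcongr) hm
      simp only [hFF, hnR, if_true]
      rw [← mul_sub, abs_mul]
      exact (mul_le_of_le_one_left (abs_nonneg _) (dchi_abs_le n)).trans h1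
    · have : 2 * N ≤ (n : ℝ) := by
        rw [hN]
        have := not_lt.1 (fun h => hnR (Finset.mem_range.2 h))
        exact_mod_cast this
      have h1 := pt2 (g := n * d) (by rw [← hpi]; gcongr) hm
      simp only [hFF, hnR, if_false]
      rw [zero_sub, abs_neg, abs_mul]
      exact (mul_le_of_le_one_left (abs_nonneg _) (dchi_abs_le n)).trans h1
  have hfin := tsum_of_norm_bounded hZs hbound
  rw [hdiff.tsum_eq, Real.norm_eq_abs] at hfin
  rw [hx, hphi, ← mul_sub, abs_mul, abs_of_pos (by positivity : 0 < 1 / (4 * N))]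
  have hZ0 : 0 ≤ Z := tsum_nonneg fun n => by positivity
  calc _ ≤ 1 / (4 * N) * (726000 / (d ^ 3 * m ^ 3) * Z) := by gcongr
    _ = 2 * 726000 * Z * (N ^ 2 / m ^ 3) * (1 / π ^ 3) := by
        rw [hd]; field_simp; norm_num
    _ ≤ 2 * 726000 * Z * (N ^ 2 / m ^ 3) * 1 := by
        gcongr
        rw [div_le_one (by positivity)]
        exact one_le_pow₀ (by linarith [Real.pi_gt_three])
    _ = _ := by ring

theorem A_vs_phi :
    ∃ C : ℝ, ∀ s k : ℕ,
      |(4 : ℝ) ^ (-(k : ℤ)) * (xfun (2 ^ s) k : ℝ) - phis s ((k : ℝ) - 1)| ≤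
        C * (8 : ℝ) ^ (-(s : ℤ)) := by
  obtain ⟨Cp, hCp, hphi⟩ := phi_bound
  set Z := ∑' n : ℕ, 1 / (n : ℝ) ^ 3 with hZ
  have hZ0 : 0 ≤ Z := tsum_nonneg fun n => by positivity
  refine ⟨362880 * 512 + Cp + 2 * 726000 * Z, fun s k => ?_⟩
  set N : ℝ := 2 ^ s with hN
  have hNpos : 0 < N := by positivity
  have hN1 : 1 ≤ N := one_le_pow₀ (by norm_num)
  have h8 : (8 : ℝ) ^ (-(s : ℤ)) = 1 / N ^ 3 := by
    rw [zpow_neg, zpow_natCast, hN, ← pow_mul, mul_comm, pow_mul, one_div]; norm_num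
  have h4 : (4 : ℝ) ^ (-(s : ℤ)) = 1 / N ^ 2 := by
    rw [zpow_neg, zpow_natCast, hN, ← pow_mul, mul_comm, pow_mul, one_div]; norm_num
  rw [h8, zpow_neg, zpow_natCast, inv_mul_eq_div]
  rcases k with _ | m
  · have h1 : xfun (2 ^ s) 0 = 0 := by
      have h1 : 0 < 2 ^ s := by positivity
      obtain ⟨j, hj⟩ : ∃ j, 2 ^ s = j + 1 := ⟨2 ^ s - 1, by omega⟩
      rw [hj, xfun]
    have h2 : phis s (((0 : ℕ) : ℝ) - 1) = 0 := by
      rw [phis, phi, if_neg, mul_zero]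
      rw [h4, not_lt]
      have : 0 < 1 / N ^ 2 := by positivity
      push_cast
      linarith
    rw [h1, h2]
    simp only [Nat.cast_zero, zero_div, sub_zero, abs_zero]
    positivity
  rw [show ((m + 1 : ℕ) : ℝ) - 1 = m by push_cast; ring]
  rcases lt_or_ge ((m : ℝ) ^ 3) (N ^ 5) with h | h
  · have hx := xfun_le_exp s (m + 1) (by omega)
    have hkpos : (0 : ℝ) < ((m + 1 : ℕ) : ℝ) := by positivity
    have hk3 : (((m + 1 : ℕ) : ℝ)) ^ 3 ≤ 8 * N ^ 5 := by
      rcases Nat.eq_zero_or_pos m with rfl | hm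
      · have : 1 ≤ N ^ 5 := one_le_pow₀ hN1
        norm_num; linarith
      · have hm1 : (1 : ℝ) ≤ m := by exact_mod_cast hm
        calc (((m + 1 : ℕ) : ℝ)) ^ 3 ≤ (2 * (m : ℝ)) ^ 3 := by
              apply pow_le_pow_left₀ hkpos.le; push_cast; linarith
          _ = 8 * (m : ℝ) ^ 3 := by ring
          _ ≤ _ := by linarith
    have hx2 : (xfun (2 ^ s) (m + 1) : ℝ) / 4 ^ (m + 1) ≤ 362880 * 512 * (1 / N ^ 3) := by
      set k : ℝ := ((m + 1 : ℕ) : ℝ) with hk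
      calc _ ≤ _ := hx
        _ ≤ (Nat.factorial 9 : ℕ) / (N ^ 2 / k) ^ 9 := exp_neg_le (by positivity) 9
        _ = 362880 * (k ^ 3) ^ 3 / N ^ 18 := by
            norm_num [Nat.factorial]; field_simp
        _ ≤ 362880 * (8 * N ^ 5) ^ 3 / N ^ 18 := by gcongr
        _ = _ := by field_simp; norm_num
    have hp2 : |phis s m| ≤ Cp * (1 / N ^ 3) := by
      rw [phis, h4]
      rcases Nat.eq_zero_or_pos m with rfl | hm
      · simp [phi]; positivity
      · have hm1 : (0 : ℝ) < m := by exact_mod_cast hm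
        rw [abs_mul, abs_of_pos (by positivity : 0 < 1 / N ^ 2)]
        calc _ ≤ 1 / N ^ 2 * (Cp * (1 / N ^ 2 * m) ^ 3) := by
              gcongr; exact hphi _ (by positivity)
          _ = Cp * (m : ℝ) ^ 3 / N ^ 8 := by field_simp
          _ ≤ Cp * N ^ 5 / N ^ 8 := by gcongr
          _ = _ := by field_simp
    have hx0 : 0 ≤ (xfun (2 ^ s) (m + 1) : ℝ) / 4 ^ (m + 1) := by positivity
    calc _ ≤ |(xfun (2 ^ s) (m + 1) : ℝ) / 4 ^ (m + 1)| + |phis s m| := abs_sub _ _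
      _ ≤ 362880 * 512 * (1 / N ^ 3) + Cp * (1 / N ^ 3) := by
          rw [abs_of_nonneg hx0]; gcongr
      _ ≤ _ := by
          have : 0 ≤ 2 * 726000 * Z * (1 / N ^ 3) := by positivity
          linarith
  · have hm : 1 ≤ m := by
      rcases Nat.eq_zero_or_pos m with rfl | hm
      · have : 0 < N ^ 5 := by positivity
        norm_num at h; linarith
      · exact hm
    have hm1 : (0 : ℝ) < m := by exact_mod_cast hm
    calc _ ≤ _ := regime_two s m hm
      _ ≤ 2 * 726000 * Z * (N ^ 2 / N ^ 5) := by gcongr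
      _ = 2 * 726000 * Z * (1 / N ^ 3) := by field_simp
      _ ≤ _ := by
          gcongr
          have : (0 : ℝ) ≤ 362880 * 512 := by norm_num
          linarith
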